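/- arXiv:2603.03622 — 2 statements merged into one kernel-verified Lean document; each statement's English description precedes it below -/
import Mathlib

section
/- There exist constants C₁ > 0 and c₁ > 0 such that for all integers n ≥ 1 and m ≥ 1, the probability that |𝔇_n| ≥ m is at most C₁·exp(−c₁·m²/(m ∨ n)), where m ∨ n denotes max(m,n). -/
open MeasureTheory ProbabilityTheory Filter

/-- The asymptotic condition `1/w(n) = n^α (1 + 2B/n + O(1/n²))` on the weight function. -/
def WeightAsymp (w : ℕ → ℝ) (α B : ℝ) : Prop :=
  ∃ C₀ > (0:ℝ), ∃ N₀ : ℕ, ∀ n : ℕ, N₀ ≤ n →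
    |1 / w n - (n:ℝ) ^ α - 2 * B * (n:ℝ) ^ (α - 1)| ≤ C₀ * (n:ℝ) ^ (α - 2)

/-- The three admissible choices of `(b, r)` in terms of the weight function `w`. -/
def UrnChoice (w b r : ℕ → ℝ) : Prop :=
  (∀ i, b i = w (2*i) ∧ r i = w (2*i+1)) ∨
  (∀ i, b i = w (2*i+1) ∧ r i = w (2*i)) ∨
  (∀ i, b i = w (2*i) ∧ r i = w (2*i))

/-- A generalized Pólya urn process: `Bl n` and `Re n` are the numbers of blue and red
balls drawn in the first `n` draws; started at `(0,0)`, exactly one coordinate increases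
by `1` at each step, and conditionally on the past the blue coordinate increases with
probability `b(Bl n)/(b(Bl n) + r(Re n))`. -/
structure Urn {Ω : Type*} [MeasurableSpace Ω] (μ : Measure Ω) (b r : ℕ → ℝ) where
  Bl : ℕ → Ω → ℕ
  Re : ℕ → Ω → ℕ
  meas_Bl : ∀ n, Measurable (Bl n)
  meas_Re : ∀ n, Measurable (Re n)
  init_Bl : ∀ ω, Bl 0 ω = 0
  init_Re : ∀ ω, Re 0 ω = 0
  step : ∀ n ω, (Bl (n+1) ω = Bl n ω + 1 ∧ Re (n+1) ω = Re n ω) ∨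
                (Bl (n+1) ω = Bl n ω ∧ Re (n+1) ω = Re n ω + 1)
  markov : ∀ n : ℕ,
    μ[(fun ω => if Bl (n+1) ω = Bl n ω + 1 then (1:ℝ) else 0) |
        ⨆ j ∈ Set.Iic n, MeasurableSpace.comap (fun ω => (Bl j ω, Re j ω)) inferInstance]
      =ᵐ[μ] fun ω => b (Bl n ω) / (b (Bl n ω) + r (Re n ω))

namespace Urn

variable {Ω : Type*} [MeasurableSpace Ω] {μ : Measure Ω} {b r : ℕ → ℝ}

/-- The discrepancy `𝔇_n = ℜ_n − 𝔅_n`. -/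
def D (U : Urn μ b r) (n : ℕ) (ω : Ω) : ℤ := (U.Re n ω : ℤ) - (U.Bl n ω : ℤ)

/-- `τ_k^𝔅`, the number of draws until the `k`-th blue ball. -/
noncomputable def tau (U : Urn μ b r) : ℕ → Ω → ℕ
  | 0 => fun _ => 0
  | k+1 => fun ω => sInf {n : ℕ | U.tau k ω < n ∧ U.Bl n ω = U.Bl (n-1) ω + 1}

/-- The natural filtration `ℱ_n = σ((𝔅_j, ℜ_j), j ≤ n)`. -/
def F (U : Urn μ b r) (n : ℕ) : MeasurableSpace Ω :=
  ⨆ j ∈ Set.Iic n, MeasurableSpace.comap (fun ω => (U.Bl j ω, U.Re j ω)) inferInstance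

end Urn

/-- The reciprocal weight is eventually within relative error `O(1/n)` of `n ^ α`, with constants
extracted from the second order expansion. -/
lemma WeightAsymp.exists_inv_sub_rpow_le {w : ℕ → ℝ} {α B : ℝ} (h : WeightAsymp w α B) :
    ∃ K > (0:ℝ), ∃ N : ℕ, ∀ n : ℕ, N ≤ n →
      1 ≤ n ∧ |1 / w n - (n:ℝ) ^ α| ≤ K * (n:ℝ) ^ α / n ∧ (n:ℝ) ^ α ≤ 2 * (1 / w n) ∧
        1 / w n ≤ 2 * (n:ℝ) ^ α := by
  obtain ⟨C₀, hC₀, N₀, hN₀⟩ := h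
  refine ⟨2 * |B| + C₀, by positivity, max (max N₀ 1) ⌈2 * (2 * |B| + C₀)⌉₊, fun n hn => ?_⟩
  simp only [max_le_iff, Nat.ceil_le] at hn
  obtain ⟨⟨hn0, hn1⟩, hnK⟩ := hn
  have hn1' : (1:ℝ) ≤ n := by exact_mod_cast hn1
  have hpos : (0:ℝ) < n := by linarith
  have hα1 : (n:ℝ) ^ (α - 1) = (n:ℝ) ^ α / n := by rw [Real.rpow_sub_one hpos.ne']
  have hα2 : (n:ℝ) ^ (α - 2) ≤ (n:ℝ) ^ α / n := by
    rw [← hα1]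
    exact Real.rpow_le_rpow_of_exponent_le hn1' (by linarith)
  have hpow : (0:ℝ) < (n:ℝ) ^ α := Real.rpow_pos_of_pos hpos α
  have hmain : |1 / w n - (n:ℝ) ^ α| ≤ (2 * |B| + C₀) * (n:ℝ) ^ α / n := by
    calc |1 / w n - (n:ℝ) ^ α|
        = |(1 / w n - (n:ℝ) ^ α - 2 * B * (n:ℝ) ^ (α - 1)) + 2 * B * (n:ℝ) ^ (α - 1)| := by
          congr 1; ring
      _ ≤ _ := abs_add_le _ _
      _ ≤ C₀ * ((n:ℝ) ^ α / n) + 2 * |B| * ((n:ℝ) ^ α / n) := by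
          gcongr
          · exact (hN₀ n hn0).trans (by gcongr)
          · rw [hα1, abs_mul, abs_mul, abs_two, abs_of_pos (div_pos hpow hpos)]
      _ = _ := by ring
  have hhalf : (2 * |B| + C₀) * (n:ℝ) ^ α / n ≤ (n:ℝ) ^ α / 2 := by
    rw [div_le_div_iff₀ hpos two_pos]
    nlinarith
  have := abs_le.1 (hmain.trans hhalf)
  exact ⟨hn1, hmain, by linarith, by linarith⟩

/-- Up to a relative error `O((x + y + 1) ^ (-1/2))`, the weight function is nonincreasing. -/
lemma WeightAsymp.exists_sub_le {w : ℕ → ℝ} {α B : ℝ} (h : WeightAsymp w α B) (hα : 0 < α)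
    (hw : ∀ n, 0 < w n) :
    ∃ C > (0:ℝ), ∀ x y : ℕ, x ≤ y → w y - w x ≤ C / √(x + y + 1) * (w x + w y) := by
  obtain ⟨K, hK, N, hN⟩ := h.exists_inv_sub_rpow_le
  obtain ⟨A, hA⟩ : ∃ A : ℝ, ∀ x < N, 1 / w x ≤ A := by
    refine ⟨∑ x ∈ Finset.range N, 1 / w x, fun x hx => ?_⟩
    exact Finset.single_le_sum (f := fun x => 1 / w x) (fun i _ => (one_div_pos.2 (hw i)).le)
      (Finset.mem_range.2 hx)
  have ht : Tendsto (fun y : ℕ => (y:ℝ) ^ (α / 2)) atTop atTop :=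
    (tendsto_rpow_atTop (half_pos hα)).comp tendsto_natCast_atTop_atTop
  obtain ⟨Y, hY⟩ := eventually_atTop.1 (ht.eventually_ge_atTop (max 4 (2 * A)))
  have key : ∃ C > (0:ℝ), ∀ x y : ℕ, x ≤ y →
      1 / w x - 1 / w y ≤ C / √(x + y + 1) * (1 / w x + 1 / w y) := by
    set L := max Y (N ^ 2)
    refine ⟨√(2 * L + 1) + 4 * K, by positivity, fun x y hxy => ?_⟩
    have hx := one_div_pos.2 (hw x)
    have hy := one_div_pos.2 (hw y)
    have hxy' : (x:ℝ) ≤ y := by exact_mod_cast hxy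
    have hs : 0 < √((x:ℝ) + y + 1) := by positivity
    rcases lt_or_ge y L with hyL | hyL
    · have hyL' : (y:ℝ) ≤ L := by exact_mod_cast hyL.le
      have h1 : 1 ≤ (√(2 * L + 1) + 4 * K) / √((x:ℝ) + y + 1) := by
        rw [one_le_div hs]
        have : √((x:ℝ) + y + 1) ≤ √(2 * L + 1) := Real.sqrt_le_sqrt (by linarith)
        linarith
      nlinarith
    have hyY : Y ≤ y := (le_max_left _ _).trans hyL
    have hyN : N ^ 2 ≤ y := (le_max_right _ _).trans hyL
    have hNy : N ≤ y := (Nat.le_self_pow two_ne_zero N).trans hyN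
    obtain ⟨hy1, hyd, hyl, hyu⟩ := hN y hNy
    have hy1' : (1:ℝ) ≤ y := by exact_mod_cast hy1
    have hbig := hY y hyY
    simp only [max_le_iff] at hbig
    have hsq : (y:ℝ) ^ α = (y:ℝ) ^ (α / 2) * (y:ℝ) ^ (α / 2) := by
      rw [← Real.rpow_add (by linarith)]; congr 1; ring
    rcases lt_or_ge (x ^ 2) y with hx2 | hx2
    · have hle : 1 / w x ≤ 1 / w y := by
        rcases lt_or_ge x N with hxN | hxN
        · have := hA x hxN
          nlinarith
        · obtain ⟨-, -, -, hxu⟩ := hN x hxN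
          have hxp : (x:ℝ) ^ α ≤ (y:ℝ) ^ (α / 2) := by
            have h2 : (x:ℝ) ^ α = ((x:ℝ) ^ 2) ^ (α / 2) := by
              rw [← Real.rpow_natCast, ← Real.rpow_mul (by positivity)]
              congr 1; push_cast; ring
            rw [h2]
            exact Real.rpow_le_rpow (by positivity) (by exact_mod_cast hx2.le) (by positivity)
          nlinarith
      have : 0 ≤ (√(2 * L + 1) + 4 * K) / √((x:ℝ) + y + 1) * (1 / w x + 1 / w y) := by
        positivity
      linarith
    · have hxN : N ≤ x := (Nat.pow_le_pow_iff_left two_ne_zero).1 (hyN.trans hx2)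
      obtain ⟨hx1, hxd, hxl, hxu⟩ := hN x hxN
      have hx1' : (1:ℝ) ≤ x := by exact_mod_cast hx1
      have hsx : √((x:ℝ) + y + 1) ≤ 2 * x := by
        rw [Real.sqrt_le_left (by linarith)]
        have : (y:ℝ) ≤ (x:ℝ) ^ 2 := by exact_mod_cast hx2
        nlinarith
      have hmono : (x:ℝ) ^ α ≤ (y:ℝ) ^ α := Real.rpow_le_rpow (by positivity) hxy' hα.le
      have bound : ∀ z : ℕ, (x:ℝ) ≤ z → (z:ℝ) ^ α ≤ 2 * (1 / w z) →
          K * (z:ℝ) ^ α / z ≤ 4 * K / √((x:ℝ) + y + 1) * (1 / w z) := by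
        intro z hz hzl
        have hwz := one_div_pos.2 (hw z)
        have hz0 : (0:ℝ) < z := by linarith
        calc K * (z:ℝ) ^ α / z ≤ K * (2 * (1 / w z)) / z := by gcongr
          _ = 4 * K / (2 * z) * (1 / w z) := by field_simp; ring
          _ ≤ 4 * K / √((x:ℝ) + y + 1) * (1 / w z) := by
              gcongr
              linarith
      have bound_x := bound x le_rfl hxl
      have bound_y := bound y hxy' hyl
      have h1 := (abs_le.1 hxd).2
      have h2 := (abs_le.1 hyd).1
      have h3 : 0 ≤ √(2 * L + 1) / √((x:ℝ) + y + 1) * (1 / w x + 1 / w y) := by positivity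
      rw [add_div]
      linarith
  obtain ⟨C, hC, hkey⟩ := key
  refine ⟨C, hC, fun x y hxy => ?_⟩
  have hx := hw x
  have hy := hw y
  calc w y - w x = (w x * w y) * (1 / w x - 1 / w y) := by field_simp
    _ ≤ (w x * w y) * (C / √(x + y + 1) * (1 / w x + 1 / w y)) := by
        gcongr
        exact hkey x y hxy
    _ = _ := by field_simp; ring

/-- The color that is ahead is drawn with probability at most `1/2 + O((i + j + 1) ^ (-1/2))`. -/
lemma UrnChoice.exists_drift_le {w b r : ℕ → ℝ} {α B : ℝ} (hchoice : UrnChoice w b r)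
    (h : WeightAsymp w α B) (hα : 0 < α) (hw : ∀ n, 0 < w n) :
    ∃ C > (0:ℝ), ∀ i j : ℕ,
      (i < j → r j - b i ≤ C / √((i + j : ℕ) + 1) * (b i + r j)) ∧
      (j < i → b i - r j ≤ C / √((i + j : ℕ) + 1) * (b i + r j)) := by
  obtain ⟨C, hC, hdrift⟩ := h.exists_sub_le hα hw
  refine ⟨C, hC, fun i j => ?_⟩
  have key : ∀ x y : ℕ, x ≤ y → i + j ≤ x + y →
      w y - w x ≤ C / √((i + j : ℕ) + 1) * (w x + w y) := by
    intro x y hxy hij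
    have hx := hw x
    have hy := hw y
    have hij' : ((i + j : ℕ) : ℝ) ≤ x + y := by exact_mod_cast hij
    refine (hdrift x y hxy).trans ?_
    gcongr
  rcases hchoice with hc | hc | hc <;> rw [(hc i).1, (hc j).2] <;>
    refine ⟨fun hij => key _ _ (by omega) (by omega), fun hij => ?_⟩ <;>
    rw [add_comm (w _)] <;> exact key _ _ (by omega) (by omega)

lemma Real.sinh_le_two_mul_mul_cosh {x : ℝ} (hx : 0 ≤ x) :
    Real.sinh x ≤ 2 * x * Real.cosh x := by
  rw [Real.sinh_eq, Real.cosh_eq]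
  have h1 := Real.add_one_le_exp (-2 * x)
  have h2 : Real.exp (-x) = Real.exp x * Real.exp (-2 * x) := by
    rw [← Real.exp_add]; congr 1; ring
  have h3 := Real.exp_pos x
  have h4 := Real.exp_pos (-x)
  nlinarith [mul_nonneg hx h4.le, mul_le_mul_of_nonneg_left h1 h3.le]

namespace Urn

variable {Ω : Type*} [MeasurableSpace Ω] {μ : Measure Ω} {b r : ℕ → ℝ}

lemma Bl_add_Re (U : Urn μ b r) (n : ℕ) (ω : Ω) : U.Bl n ω + U.Re n ω = n := by
  induction n with
  | zero => simp [U.init_Bl, U.init_Re]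
  | succ n ih => rcases U.step n ω with h | h <;> omega

lemma abs_D_le (U : Urn μ b r) (n : ℕ) (ω : Ω) : |U.D n ω| ≤ n := by
  have := U.Bl_add_Re n ω
  rw [D, abs_le]
  omega

lemma F_le (U : Urn μ b r) (n : ℕ) : U.F n ≤ ‹MeasurableSpace Ω› :=
  iSup₂_le fun j _ => ((U.meas_Bl j).prodMk (U.meas_Re j)).comap_le

lemma measurable_D_F (U : Urn μ b r) (n : ℕ) : Measurable[U.F n] (U.D n) := by
  have h : Measurable[U.F n] (fun ω => (U.Bl n ω, U.Re n ω)) :=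
    (comap_measurable _).mono
      (le_iSup₂_of_le (f := fun j (_ : j ∈ Set.Iic n) =>
        MeasurableSpace.comap (fun ω => (U.Bl j ω, U.Re j ω)) inferInstance)
        n (Set.mem_Iic.2 le_rfl) le_rfl) le_rfl
  exact (measurable_of_countable (fun p : ℕ × ℕ => (p.2 : ℤ) - (p.1 : ℤ))).comp h

lemma stronglyMeasurable_comp_D (U : Urn μ b r) (n : ℕ) (f : ℤ → ℝ) :
    StronglyMeasurable[U.F n] (fun ω => f (U.D n ω)) :=
  ((measurable_of_countable f).comp (U.measurable_D_F n)).stronglyMeasurable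

lemma exists_norm_comp_D_le (U : Urn μ b r) (n : ℕ) (f : ℤ → ℝ) :
    ∃ c, ∀ ω, ‖f (U.D n ω)‖ ≤ c := by
  refine ⟨∑ k ∈ Finset.Icc (-n : ℤ) n, ‖f k‖, fun ω => ?_⟩
  exact Finset.single_le_sum (f := fun k => ‖f k‖) (fun _ _ => norm_nonneg _)
    (Finset.mem_Icc.2 (abs_le.1 (U.abs_D_le n ω)))

lemma integrable_comp_D [IsFiniteMeasure μ] (U : Urn μ b r) (n : ℕ) (f : ℤ → ℝ) :
    Integrable (fun ω => f (U.D n ω)) μ := by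
  obtain ⟨c, hc⟩ := U.exists_norm_comp_D_le n f
  exact .of_bound ((U.stronglyMeasurable_comp_D n f).mono (U.F_le n)).aestronglyMeasurable c
    (.of_forall hc)

/-- The indicator of drawing a blue ball at step `n + 1`. -/
noncomputable def blueStep (U : Urn μ b r) (n : ℕ) (ω : Ω) : ℝ :=
  if U.Bl (n + 1) ω = U.Bl n ω + 1 then 1 else 0

lemma integrable_blueStep [IsFiniteMeasure μ] (U : Urn μ b r) (n : ℕ) :
    Integrable (U.blueStep n) μ := by
  refine .of_bound (Measurable.ite (measurableSet_eq_fun (U.meas_Bl _)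
    ((U.meas_Bl n).add_const 1)) measurable_const measurable_const).aestronglyMeasurable 1
    (.of_forall fun ω => ?_)
  unfold blueStep
  split_ifs <;> simp

lemma integral_comp_D_mul_blueStep [IsFiniteMeasure μ] (U : Urn μ b r) (n : ℕ) (f : ℤ → ℝ) :
    Integrable (fun ω => f (U.D n ω) * U.blueStep n ω) μ ∧
    Integrable (fun ω => f (U.D n ω) * (b (U.Bl n ω) / (b (U.Bl n ω) + r (U.Re n ω)))) μ ∧
    ∫ ω, f (U.D n ω) * U.blueStep n ω ∂μ =
      ∫ ω, f (U.D n ω) * (b (U.Bl n ω) / (b (U.Bl n ω) + r (U.Re n ω))) ∂μ := by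
  obtain ⟨c, hc⟩ := U.exists_norm_comp_D_le n f
  have hint : Integrable (fun ω => f (U.D n ω) * U.blueStep n ω) μ :=
    (U.integrable_blueStep n).bdd_mul (c := c)
      ((U.stronglyMeasurable_comp_D n f).mono (U.F_le n)).aestronglyMeasurable (.of_forall hc)
  have hpull := condExp_mul_of_stronglyMeasurable_left (U.stronglyMeasurable_comp_D n f) hint
    (U.integrable_blueStep n)
  have hmk : μ[U.blueStep n | U.F n] =ᵐ[μ]
      fun ω => b (U.Bl n ω) / (b (U.Bl n ω) + r (U.Re n ω)) := U.markov n
  have heq : μ[(fun ω => f (U.D n ω)) * U.blueStep n | U.F n] =ᵐ[μ]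
      fun ω => f (U.D n ω) * (b (U.Bl n ω) / (b (U.Bl n ω) + r (U.Re n ω))) := by
    filter_upwards [hpull, hmk] with ω h1 h2
    rw [h1, Pi.mul_apply, h2]
  refine ⟨hint, integrable_condExp.congr heq, ?_⟩
  rw [← integral_congr_ae heq, integral_condExp (U.F_le n)]
  rfl

lemma cosh_mul_D_succ (U : Urn μ b r) (l : ℝ) (n : ℕ) (ω : Ω) :
    Real.cosh (l * U.D (n + 1) ω) = Real.cosh l * Real.cosh (l * U.D n ω) +
      Real.sinh l * Real.sinh (l * U.D n ω) -
      2 * Real.sinh l * (Real.sinh (l * U.D n ω) * U.blueStep n ω) := by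
  rcases U.step n ω with ⟨h1, h2⟩ | ⟨h1, h2⟩
  · have hD : (U.D (n + 1) ω : ℝ) = U.D n ω - 1 := by
      simp only [D, h1, h2]; push_cast; ring
    rw [hD, mul_sub, mul_one, Real.cosh_sub, blueStep, if_pos h1]
    ring
  · have hD : (U.D (n + 1) ω : ℝ) = U.D n ω + 1 := by
      simp only [D, h1, h2]; push_cast; ring
    rw [hD, mul_add, mul_one, Real.cosh_add, blueStep, if_neg (by omega)]
    ring

lemma sinh_mul_D_mul_drift_le (U : Urn μ b r) (hb : ∀ i, 0 < b i) (hr : ∀ i, 0 < r i)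
    {C : ℝ} (hC : 0 < C)
    (hdrift : ∀ i j : ℕ,
      (i < j → r j - b i ≤ C / √((i + j : ℕ) + 1) * (b i + r j)) ∧
      (j < i → b i - r j ≤ C / √((i + j : ℕ) + 1) * (b i + r j)))
    {l : ℝ} (hl : 0 ≤ l) (n : ℕ) (ω : Ω) :
    Real.sinh (l * U.D n ω) * (1 - 2 * (b (U.Bl n ω) / (b (U.Bl n ω) + r (U.Re n ω)))) ≤
      C / √(n + 1) * Real.cosh (l * U.D n ω) := by
  have hn := U.Bl_add_Re n ω
  obtain ⟨h1, h2⟩ := hdrift (U.Bl n ω) (U.Re n ω)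
  rw [hn] at h1 h2
  have hbi := hb (U.Bl n ω)
  have hrj := hr (U.Re n ω)
  have hε : 0 < C / √((n:ℝ) + 1) := by positivity
  have hp : 1 - 2 * (b (U.Bl n ω) / (b (U.Bl n ω) + r (U.Re n ω))) =
      (r (U.Re n ω) - b (U.Bl n ω)) / (b (U.Bl n ω) + r (U.Re n ω)) := by
    field_simp; ring
  rw [hp]
  have hs1 := Real.sinh_lt_cosh (l * U.D n ω)
  have hs2 := Real.sinh_lt_cosh (-(l * U.D n ω))
  rw [Real.sinh_neg, Real.cosh_neg] at hs2
  have hc := Real.cosh_pos (l * U.D n ω)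
  rcases lt_trichotomy (U.Bl n ω) (U.Re n ω) with hlt | heq | hlt
  · have hD : (0:ℝ) ≤ U.D n ω := by
      have : 0 ≤ U.D n ω := by rw [D]; omega
      exact_mod_cast this
    have hs : 0 ≤ Real.sinh (l * U.D n ω) := Real.sinh_nonneg_iff.2 (mul_nonneg hl hD)
    have hq : (r (U.Re n ω) - b (U.Bl n ω)) / (b (U.Bl n ω) + r (U.Re n ω)) ≤
        C / √((n:ℝ) + 1) := (div_le_iff₀ (by positivity)).2 (h1 hlt)
    nlinarith
  · have hD : U.D n ω = 0 := by rw [D]; omega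
    simp [hD, hε.le]
  · have hD : (U.D n ω : ℝ) ≤ 0 := by
      have : U.D n ω ≤ 0 := by rw [D]; omega
      exact_mod_cast this
    have hs : Real.sinh (l * U.D n ω) ≤ 0 :=
      Real.sinh_nonpos_iff.2 (mul_nonpos_of_nonneg_of_nonpos hl hD)
    have hq : -((r (U.Re n ω) - b (U.Bl n ω)) / (b (U.Bl n ω) + r (U.Re n ω))) ≤
        C / √((n:ℝ) + 1) := by
      rw [← neg_div, neg_sub]
      exact (div_le_iff₀ (by positivity)).2 (h2 hlt)
    nlinarith

lemma integral_cosh_mul_D_succ_le [IsFiniteMeasure μ] (U : Urn μ b r) (hb : ∀ i, 0 < b i)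
    (hr : ∀ i, 0 < r i) {C : ℝ} (hC : 0 < C)
    (hdrift : ∀ i j : ℕ,
      (i < j → r j - b i ≤ C / √((i + j : ℕ) + 1) * (b i + r j)) ∧
      (j < i → b i - r j ≤ C / √((i + j : ℕ) + 1) * (b i + r j)))
    {l : ℝ} (hl : 0 ≤ l) (n : ℕ) :
    ∫ ω, Real.cosh (l * U.D (n + 1) ω) ∂μ ≤
      (Real.cosh l + Real.sinh l * (C / √(n + 1))) * ∫ ω, Real.cosh (l * U.D n ω) ∂μ := by
  obtain ⟨hi1, hi2, heq⟩ := U.integral_comp_D_mul_blueStep n (fun k => Real.sinh (l * k))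
  have hci := U.integrable_comp_D n (fun k => Real.cosh (l * k))
  have hsi := U.integrable_comp_D n (fun k => Real.sinh (l * k))
  have hcs : Integrable (fun ω => Real.cosh l * Real.cosh (l * U.D n ω) +
      Real.sinh l * Real.sinh (l * U.D n ω)) μ := (hci.const_mul _).add (hsi.const_mul _)
  have hsl : 0 ≤ Real.sinh l := Real.sinh_nonneg_iff.2 hl
  have hexp : ∫ ω, Real.cosh (l * U.D (n + 1) ω) ∂μ =
      ∫ ω, (Real.cosh l * Real.cosh (l * U.D n ω) + Real.sinh l * Real.sinh (l * U.D n ω) -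
        2 * Real.sinh l * (Real.sinh (l * U.D n ω) *
          (b (U.Bl n ω) / (b (U.Bl n ω) + r (U.Re n ω))))) ∂μ := by
    simp_rw [U.cosh_mul_D_succ l n]
    rw [integral_sub hcs (hi1.const_mul _), integral_sub hcs (hi2.const_mul _),
      integral_const_mul (2 * Real.sinh l), integral_const_mul (2 * Real.sinh l), heq]
  rw [hexp, ← integral_const_mul]
  refine integral_mono (hcs.sub (hi2.const_mul _)) (hci.const_mul _) fun ω => ?_
  have := mul_le_mul_of_nonneg_left (U.sinh_mul_D_mul_drift_le hb hr hC hdrift hl n ω) hsl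
  dsimp only
  linarith

lemma integral_cosh_mul_D_le [IsProbabilityMeasure μ] (U : Urn μ b r) (hb : ∀ i, 0 < b i)
    (hr : ∀ i, 0 < r i) {C : ℝ} (hC : 0 < C)
    (hdrift : ∀ i j : ℕ,
      (i < j → r j - b i ≤ C / √((i + j : ℕ) + 1) * (b i + r j)) ∧
      (j < i → b i - r j ≤ C / √((i + j : ℕ) + 1) * (b i + r j)))
    {l : ℝ} (hl : 0 ≤ l) (n : ℕ) :
    ∫ ω, Real.cosh (l * U.D n ω) ∂μ ≤ Real.exp (n * l ^ 2 / 2 + 4 * C * l * √n) := by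
  induction n with
  | zero => simp [D, U.init_Bl, U.init_Re]
  | succ n ih =>
    have hs : 0 < √((n:ℝ) + 1) := by positivity
    have hsq1 : √((n:ℝ) + 1) ^ 2 = n + 1 := Real.sq_sqrt (by positivity)
    have hsq2 : √(n:ℝ) ^ 2 = n := Real.sq_sqrt (by positivity)
    have hstep : C / √((n:ℝ) + 1) ≤ 2 * C * (√(n + 1) - √n) := by
      rw [div_le_iff₀ hs]
      nlinarith [sq_nonneg (√((n:ℝ) + 1) - √n)]
    have hfac : Real.cosh l + Real.sinh l * (C / √(n + 1)) ≤
        Real.exp (l ^ 2 / 2) * Real.exp (4 * C * l * (√(n + 1) - √n)) := by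
      calc Real.cosh l + Real.sinh l * (C / √(n + 1))
          ≤ Real.cosh l + (2 * l * Real.cosh l) * (2 * C * (√(n + 1) - √n)) := by
            gcongr
            exact Real.sinh_le_two_mul_mul_cosh hl
        _ = Real.cosh l * (4 * C * l * (√(n + 1) - √n) + 1) := by ring
        _ ≤ Real.cosh l * Real.exp (4 * C * l * (√(n + 1) - √n)) := by
            gcongr
            exact Real.add_one_le_exp _
        _ ≤ _ := by
            gcongr
            exact Real.cosh_le_exp_half_sq l
    calc ∫ ω, Real.cosh (l * U.D (n + 1) ω) ∂μ
        ≤ (Real.cosh l + Real.sinh l * (C / √(n + 1))) * ∫ ω, Real.cosh (l * U.D n ω) ∂μ :=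
          U.integral_cosh_mul_D_succ_le hb hr hC hdrift hl n
      _ ≤ (Real.exp (l ^ 2 / 2) * Real.exp (4 * C * l * (√(n + 1) - √n))) *
          Real.exp (n * l ^ 2 / 2 + 4 * C * l * √n) := by
          gcongr
      _ = _ := by
          rw [← Real.exp_add, ← Real.exp_add]
          congr 1
          push_cast
          ring

lemma measureReal_le_abs_D_le [IsProbabilityMeasure μ] (U : Urn μ b r) (hb : ∀ i, 0 < b i)
    (hr : ∀ i, 0 < r i) {C : ℝ} (hC : 0 < C)
    (hdrift : ∀ i j : ℕ,
      (i < j → r j - b i ≤ C / √((i + j : ℕ) + 1) * (b i + r j)) ∧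
      (j < i → b i - r j ≤ C / √((i + j : ℕ) + 1) * (b i + r j)))
    {n : ℕ} (hn : 1 ≤ n) (m : ℕ) :
    μ.real {ω | (m : ℤ) ≤ |U.D n ω|} ≤
      2 * Real.exp (16 * C ^ 2) * Real.exp (-(1 / 4) * (m:ℝ) ^ 2 / n) := by
  have hn0 : (0:ℝ) < n := by exact_mod_cast hn
  set l : ℝ := m / n with hldef
  have hl : 0 ≤ l := by positivity
  have hmarkov := mul_meas_ge_le_integral_of_nonneg (μ := μ)
    (.of_forall fun ω => (Real.cosh_pos (l * U.D n ω)).le)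
    (U.integrable_comp_D n (fun k => Real.cosh (l * k))) (Real.cosh (l * m))
  have hset : {ω | (m : ℤ) ≤ |U.D n ω|} ⊆
      {ω | Real.cosh (l * m) ≤ Real.cosh (l * U.D n ω)} := by
    intro ω hω
    have hω' : (m:ℝ) ≤ |(U.D n ω : ℝ)| := by exact_mod_cast (show (m : ℤ) ≤ |U.D n ω| from hω)
    rw [Set.mem_ofPred_eq, Real.cosh_le_cosh, abs_mul, abs_mul, Nat.abs_cast]
    gcongr
  have hcosh : Real.exp (l * m) / 2 ≤ Real.cosh (l * m) := by
    rw [Real.cosh_eq]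
    linarith [Real.exp_pos (-(l * m))]
  have hmain : Real.exp (l * m) / 2 * μ.real {ω | (m : ℤ) ≤ |U.D n ω|} ≤
      Real.exp (n * l ^ 2 / 2 + 4 * C * l * √n) := by
    refine le_trans ?_ (hmarkov.trans (U.integral_cosh_mul_D_le hb hr hC hdrift hl n))
    gcongr
    exact measure_ne_top _ _
  have hexp : Real.exp (n * l ^ 2 / 2 + 4 * C * l * √n) ≤
      Real.exp (l * m) * (Real.exp (16 * C ^ 2) * Real.exp (-(1 / 4) * (m:ℝ) ^ 2 / n)) := by
    rw [← Real.exp_add, ← Real.exp_add, Real.exp_le_exp]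
    have hsq : √(n:ℝ) ^ 2 = n := Real.sq_sqrt hn0.le
    have h1 : l * m = (l * √n) ^ 2 := by rw [mul_pow, hsq, hldef]; field_simp
    have h2 : (n:ℝ) * l ^ 2 = (l * √n) ^ 2 := by rw [mul_pow, hsq]; ring
    have h3 : -(1 / 4) * (m:ℝ) ^ 2 / n = -(1 / 4) * (l * √n) ^ 2 := by
      rw [mul_pow, hsq, hldef]; field_simp
    rw [h1, h2, h3]
    nlinarith [sq_nonneg (l * √n - 8 * C)]
  have hpos := Real.exp_pos (l * m)
  refine le_of_mul_le_mul_left ?_ hpos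
  linarith

end Urn

theorem discrepancy_tail {Ω : Type*} [MeasurableSpace Ω] (μ : MeasureTheory.Measure Ω) [MeasureTheory.IsProbabilityMeasure μ]
    (α B : ℝ) (hα : 0 < α) (w : ℕ → ℝ) (hw : ∀ n, 0 < w n)
    (hasymp : WeightAsymp w α B)
    (b r : ℕ → ℝ) (hb : ∀ i, 0 < b i) (hr : ∀ i, 0 < r i)
    (hchoice : UrnChoice w b r) (U : Urn μ b r) :
    ∃ C₁ > (0:ℝ), ∃ c₁ > (0:ℝ), ∀ n : ℕ, 1 ≤ n → ∀ m : ℕ, 1 ≤ m →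
      μ {ω | (m : ℤ) ≤ |U.D n ω|} ≤
        ENNReal.ofReal (C₁ * Real.exp (-c₁ * (m:ℝ)^2 / max (m:ℝ) (n:ℝ))) := by
  obtain ⟨C, hC, hdrift⟩ := hchoice.exists_drift_le hasymp hα hw
  refine ⟨2 * Real.exp (16 * C ^ 2), by positivity, 1 / 4, by norm_num, fun n hn m _ => ?_⟩
  rcases le_or_gt m n with hmn | hmn
  · rw [max_eq_right (by exact_mod_cast hmn), ← ofReal_measureReal]
    exact ENNReal.ofReal_le_ofReal (U.measureReal_le_abs_D_le hb hr hC hdrift hn m)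
  · have hempty : {ω | (m : ℤ) ≤ |U.D n ω|} = ∅ := by
      ext ω
      have := U.abs_D_le n ω
      simp only [Set.mem_ofPred_eq, Set.mem_empty_iff_false, iff_false]
      omega
    simp [hempty]
end

section
/- There exists a constant C > 0 such that for all i ≥ 1, the conditional expectation E[𝔇_{i+1} − 𝔇_i | ℱ_i] equals −α·𝔇_i/i + ε_i, where ε_i is an ℱ_i-measurable random variable satisfying |ε_i| ≤ C·(𝔇_i² + i)/i² almost surely; here ℱ_i = σ((𝔅_j, ℜ_j), j ≤ i). -/
open MeasureTheory ProbabilityTheory Filter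

/-- Quadratic Taylor bound for `(1 + v) ^ α` near `v = 0`. -/
lemma abs_one_add_rpow_sub_le {α v : ℝ} (hα : 0 < α) (hv : |v| ≤ 1 / 2) (hαv : 2 * α * |v| ≤ 1) :
    |(1 + v) ^ α - 1 - α * v| ≤ (4 * α ^ 2 + 2 * α) * v ^ 2 := by
  have hv' := abs_le.mp hv
  have hpos : 0 < 1 + v := by linarith
  have hup : Real.log (1 + v) ≤ v := by linarith [Real.log_le_sub_one_of_pos hpos]
  have hlo : v - 2 * v ^ 2 ≤ Real.log (1 + v) := by
    refine le_trans ?_ (Real.one_sub_inv_le_log_of_pos hpos)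
    rw [← sub_nonneg]
    have : 1 - (1 + v)⁻¹ - (v - 2 * v ^ 2) = v ^ 2 * (1 + 2 * v) / (1 + v) := by
      field_simp
      ring
    rw [this]
    have : 0 ≤ 1 + 2 * v := by linarith
    positivity
  have habs : |Real.log (1 + v)| ≤ 2 * |v| := by
    have h2 : 2 * v ^ 2 ≤ |v| := by
      rw [← sq_abs v]
      nlinarith [abs_nonneg v]
    rw [abs_le]
    constructor <;> linarith [neg_abs_le v, le_abs_self v, abs_nonneg v]
  set t := Real.log (1 + v) * α with ht
  have htabs : |t| ≤ 2 * α * |v| := by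
    rw [ht, abs_mul, abs_of_pos hα]
    nlinarith
  have hexp := Real.abs_exp_sub_one_sub_id_le (htabs.trans hαv)
  have ht2 : t ^ 2 ≤ 4 * α ^ 2 * v ^ 2 := by
    rw [← sq_abs t, ← sq_abs v]
    nlinarith [abs_nonneg t]
  have hlin : |t - α * v| ≤ 2 * α * v ^ 2 := by
    rw [ht, abs_le]
    constructor <;> nlinarith [sq_nonneg v]
  rw [Real.rpow_def_of_pos hpos]
  calc |Real.exp t - 1 - α * v| = |(Real.exp t - 1 - t) + (t - α * v)| := by ring_nf
    _ ≤ |Real.exp t - 1 - t| + |t - α * v| := abs_add_le _ _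
    _ ≤ (4 * α ^ 2 + 2 * α) * v ^ 2 := by linarith

lemma WeightAsymp.exists_first_order {w : ℕ → ℝ} {α B : ℝ} (h : WeightAsymp w α B) :
    ∃ C > (0 : ℝ), ∃ N : ℕ, ∀ n : ℕ, N ≤ n → |1 / w n - (n : ℝ) ^ α| ≤ C * ((n : ℝ) ^ α / n) := by
  obtain ⟨C₀, hC₀, N₀, h⟩ := h
  refine ⟨2 * |B| + C₀, by positivity, max N₀ 1, fun n hn => ?_⟩
  have hn1 : (1 : ℝ) ≤ n := by exact_mod_cast (le_max_right _ _).trans hn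
  have h1 := h n ((le_max_left _ _).trans hn)
  rw [← Real.rpow_sub_one (by positivity)]
  have h2 : (n : ℝ) ^ (α - 2) ≤ (n : ℝ) ^ (α - 1) :=
    Real.rpow_le_rpow_of_exponent_le hn1 (by linarith)
  have h3 : |2 * B * (n : ℝ) ^ (α - 1)| = 2 * |B| * (n : ℝ) ^ (α - 1) := by
    rw [abs_mul, abs_mul, abs_of_pos (by positivity : 0 < (n : ℝ) ^ (α - 1))]
    norm_num
  calc |1 / w n - (n : ℝ) ^ α|
      = |(1 / w n - (n : ℝ) ^ α - 2 * B * (n : ℝ) ^ (α - 1)) + 2 * B * (n : ℝ) ^ (α - 1)| := by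
        ring_nf
    _ ≤ _ := abs_add_le _ _
    _ ≤ (2 * |B| + C₀) * (n : ℝ) ^ (α - 1) := by rw [h3]; nlinarith

/-- Linearisation of the rescaled inverse weight at `n = i (1 + u) + s` with `s ∈ [0, 1]`. -/
lemma WeightAsymp.exists_linearization {w : ℕ → ℝ} {α B : ℝ} (hα : 0 < α)
    (h : WeightAsymp w α B) :
    ∃ K > (0 : ℝ), ∃ δ > (0 : ℝ), ∀ (i n : ℕ) (u s : ℝ), 1 ≤ i → 0 ≤ s → s ≤ 1 →
      (n : ℝ) = i * (1 + u) + s → u ^ 2 + 1 / (i : ℝ) ≤ δ →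
      |1 / w n / (i : ℝ) ^ α - (1 + α * u)| ≤ K * (u ^ 2 + 1 / (i : ℝ)) := by
  obtain ⟨C, hC, N, h⟩ := h.exists_first_order
  obtain ⟨η, hη, hη1, hη2⟩ : ∃ η > (0 : ℝ), η ≤ 1 / 2 ∧ 2 * α * η ≤ 1 := by
    refine ⟨min (1 / 2) (1 / (2 * α)), by positivity, min_le_left _ _, ?_⟩
    calc 2 * α * min (1 / 2) (1 / (2 * α)) ≤ 2 * α * (1 / (2 * α)) := by
          gcongr; exact min_le_right _ _
      _ = 1 := by field_simp
  refine ⟨C * (2 ^ α * 2) + (4 * α ^ 2 + 2 * α) * 2 + α, by positivity,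
    min (η ^ 2 / 2) (1 / (2 * (N + 1))), by positivity, ?_⟩
  intro i n u s hi hs0 hs1 hn hδ
  have hi' : (1 : ℝ) ≤ i := by exact_mod_cast hi
  have hi0 : (0 : ℝ) < i := by linarith
  have hδ1 := hδ.trans (min_le_left _ _)
  have hδ2 := hδ.trans (min_le_right _ _)
  have hinv0 : 0 < 1 / (i : ℝ) := by positivity
  have hinv1 : 1 / (i : ℝ) ≤ 1 := by rw [div_le_one hi0]; exact hi'
  set v := u + s * (1 / (i : ℝ)) with hv
  have hnv : (n : ℝ) = i * (1 + v) := by rw [hn, hv]; field_simp; ring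
  have hs2 : 0 ≤ s * (1 / (i : ℝ)) := by positivity
  have hs3 : s * (1 / (i : ℝ)) ≤ 1 / (i : ℝ) := by nlinarith
  have hv2 : v ^ 2 ≤ 2 * (u ^ 2 + 1 / (i : ℝ)) := by
    have : (s * (1 / (i : ℝ))) ^ 2 ≤ 1 / (i : ℝ) := by nlinarith
    rw [hv]
    nlinarith [sq_nonneg (u - s * (1 / (i : ℝ)))]
  have hvη : |v| ≤ η := abs_le_of_sq_le_sq (by linarith) hη.le
  have hvhalf := hvη.trans hη1
  have hv' := abs_le.mp hvhalf
  have hnhalf : (i : ℝ) / 2 ≤ n := by rw [hnv]; nlinarith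
  have hn0 : (0 : ℝ) < n := by linarith
  have hN : N ≤ n := by
    have h1 : 1 / (i : ℝ) ≤ 1 / (2 * (N + 1)) := by nlinarith [sq_nonneg u]
    have h2 : 2 * ((N : ℝ) + 1) ≤ i := le_of_one_div_le_one_div hi0 h1
    have h3 : (N : ℝ) ≤ n := by linarith
    exact_mod_cast h3
  have hratio : (n : ℝ) ^ α / (i : ℝ) ^ α = (1 + v) ^ α := by
    rw [hnv, Real.mul_rpow hi0.le (by linarith)]
    field_simp
  have hpow : (1 + v) ^ α ≤ 2 ^ α := Real.rpow_le_rpow (by linarith) (by linarith) hα.le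
  have hipow : 0 < (i : ℝ) ^ α := by positivity
  have e1 : |1 / w n / (i : ℝ) ^ α - (1 + v) ^ α| ≤ C * (2 ^ α * 2) * (1 / (i : ℝ)) := by
    rw [← hratio, ← sub_div, abs_div, abs_of_pos hipow]
    calc |1 / w n - (n : ℝ) ^ α| / (i : ℝ) ^ α ≤ C * ((n : ℝ) ^ α / n) / (i : ℝ) ^ α := by
          gcongr; exact h n hN
      _ = C * ((n : ℝ) ^ α / (i : ℝ) ^ α * (1 / n)) := by ring
      _ ≤ C * (2 ^ α * (1 / (i / 2))) := by rw [hratio]; gcongr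
      _ = C * (2 ^ α * 2) * (1 / (i : ℝ)) := by field_simp
  have e2 : |(1 + v) ^ α - 1 - α * v| ≤ (4 * α ^ 2 + 2 * α) * (2 * (u ^ 2 + 1 / (i : ℝ))) := by
    refine (abs_one_add_rpow_sub_le hα hvhalf ?_).trans (by gcongr)
    nlinarith
  have e3 : |α * (s * (1 / (i : ℝ)))| ≤ α * (1 / (i : ℝ)) := by
    rw [abs_of_nonneg (by positivity)]
    gcongr
  have hsq := sq_nonneg u
  calc |1 / w n / (i : ℝ) ^ α - (1 + α * u)|
      = |(1 / w n / (i : ℝ) ^ α - (1 + v) ^ α) + ((1 + v) ^ α - 1 - α * v)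
          + α * (s * (1 / (i : ℝ)))| := by rw [hv]; ring_nf
    _ ≤ _ := abs_add_three _ _ _
    _ ≤ C * (2 ^ α * 2) * (1 / (i : ℝ)) + (4 * α ^ 2 + 2 * α) * (2 * (u ^ 2 + 1 / (i : ℝ)))
          + α * (1 / (i : ℝ)) := by gcongr
    _ ≤ C * (2 ^ α * 2) * (u ^ 2 + 1 / (i : ℝ))
          + (4 * α ^ 2 + 2 * α) * (2 * (u ^ 2 + 1 / (i : ℝ)))
          + α * (u ^ 2 + 1 / (i : ℝ)) := by gcongr <;> linarith
    _ = _ := by ring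

/-- If `p`, `q` are close to `1 - a`, `1 + a`, then `(p - q) / (p + q)` is close to `-a`. -/
lemma abs_sub_div_add_add_le {p q a e : ℝ} (hp : |p - (1 - a)| ≤ e) (hq : |q - (1 + a)| ≤ e)
    (he : e ≤ 1 / 2) : |(p - q) / (p + q) + a| ≤ 2 * e * (1 + |a|) := by
  have hp' := abs_le.mp hp
  have hq' := abs_le.mp hq
  have hpq : 1 ≤ p + q := by linarith
  have hpq0 : 0 < p + q := by linarith
  have key : (p - q) / (p + q) + a
      = ((p - (1 - a)) * (1 + a) + (q - (1 + a)) * (a - 1)) / (p + q) := by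
    field_simp
    ring
  have h1 : |1 + a| ≤ 1 + |a| := (abs_add_le _ _).trans (by simp)
  have h2 : |a - 1| ≤ 1 + |a| := (abs_sub _ _).trans (by simp [add_comm])
  have he0 : 0 ≤ e := (abs_nonneg _).trans hp
  rw [key, abs_div, abs_of_pos hpq0]
  refine (div_le_self (abs_nonneg _) hpq).trans ((abs_add_le _ _).trans ?_)
  rw [abs_mul, abs_mul]
  calc _ ≤ e * (1 + |a|) + e * (1 + |a|) := by gcongr
    _ = _ := by ring

lemma abs_sub_div_add_le_one {p q : ℝ} (hp : 0 < p) (hq : 0 < q) : |(p - q) / (p + q)| ≤ 1 := by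
  rw [abs_div, abs_of_pos (add_pos hp hq), div_le_one (add_pos hp hq), abs_le]
  constructor <;> linarith

lemma UrnChoice.exists_shift {w b r : ℕ → ℝ} (h : UrnChoice w b r) :
    ∃ s t : ℕ, s ≤ 1 ∧ t ≤ 1 ∧ (∀ i, b i = w (2 * i + s)) ∧ ∀ i, r i = w (2 * i + t) := by
  rcases h with h | h | h
  · exact ⟨0, 1, by simp, by simp, fun i => (h i).1, fun i => (h i).2⟩
  · exact ⟨1, 0, by simp, by simp, fun i => (h i).1, fun i => (h i).2⟩
  · exact ⟨0, 0, by simp, by simp, fun i => (h i).1, fun i => (h i).2⟩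

/-- First-order expansion of the one-step drift of the urn at the state `(x, y)`. -/
lemma exists_drift_bound {w b r : ℕ → ℝ} {α B : ℝ} (hα : 0 < α) (hasymp : WeightAsymp w α B)
    (hb : ∀ i, 0 < b i) (hr : ∀ i, 0 < r i) (hchoice : UrnChoice w b r) :
    ∃ C > (0 : ℝ), ∀ i x y : ℕ, 1 ≤ i → x + y = i →
      |(r y - b x) / (b x + r y) + α * ((y : ℝ) - x) / i|
        ≤ C * (((y : ℝ) - x) ^ 2 + i) / (i : ℝ) ^ 2 := by
  obtain ⟨s, t, hs, ht, hbs, hrt⟩ := hchoice.exists_shift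
  obtain ⟨K, hK, δ, hδ, h⟩ := hasymp.exists_linearization hα
  set δ' := min δ (1 / (2 * K)) with hδ'
  have hδ'0 : 0 < δ' := by positivity
  refine ⟨2 * K * (1 + α) + (1 + α) / δ', by positivity, ?_⟩
  intro i x y hi hxy
  have hi0 : (0 : ℝ) < i := by exact_mod_cast hi
  have hxy' : (x : ℝ) + y = i := by exact_mod_cast hxy
  set u := ((y : ℝ) - x) / i with hu
  have hu1 : |u| ≤ 1 := by
    rw [hu, abs_div, abs_of_pos hi0, div_le_one hi0, abs_le]
    have := (Nat.cast_nonneg x : (0 : ℝ) ≤ x)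
    have := (Nat.cast_nonneg y : (0 : ℝ) ≤ y)
    constructor <;> linarith
  have hrhs (C : ℝ) : C * (((y : ℝ) - x) ^ 2 + i) / (i : ℝ) ^ 2 = C * (u ^ 2 + 1 / i) := by
    rw [hu]
    field_simp
  have hαu : |α * u| ≤ α := by
    rw [abs_mul, abs_of_pos hα]
    nlinarith
  rw [hrhs, mul_div_assoc, ← hu]
  have hu0 : 0 ≤ u ^ 2 + 1 / (i : ℝ) := by positivity
  rcases le_or_gt (u ^ 2 + 1 / (i : ℝ)) δ' with hsmall | hlarge
  · have hsδ : u ^ 2 + 1 / (i : ℝ) ≤ δ := hsmall.trans (min_le_left _ _)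
    have hsK : K * (u ^ 2 + 1 / (i : ℝ)) ≤ 1 / 2 := by
      calc K * (u ^ 2 + 1 / (i : ℝ)) ≤ K * (1 / (2 * K)) := by
            gcongr; exact hsmall.trans (min_le_right _ _)
        _ = 1 / 2 := by field_simp
    have hp := h i (2 * x + s) (-u) s hi (by positivity) (by exact_mod_cast hs)
      (by rw [hu]; push_cast; field_simp; linarith) (by simpa using hsδ)
    have hq := h i (2 * y + t) u t hi (by positivity) (by exact_mod_cast ht)
      (by rw [hu]; push_cast; field_simp; linarith) hsδ
    rw [← hbs, neg_sq, mul_neg, ← sub_eq_add_neg] at hp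
    rw [← hrt] at hq
    have hmain := abs_sub_div_add_add_le hp hq hsK
    have hbx := hb x
    have hry := hr y
    have hip : 0 < (i : ℝ) ^ α := by positivity
    have hfrac : (1 / b x / (i : ℝ) ^ α - 1 / r y / (i : ℝ) ^ α)
        / (1 / b x / (i : ℝ) ^ α + 1 / r y / (i : ℝ) ^ α) = (r y - b x) / (b x + r y) := by
      field_simp
      ring
    rw [hfrac] at hmain
    refine hmain.trans ?_
    have h1 : 0 ≤ (1 + α) / δ' * (u ^ 2 + 1 / (i : ℝ)) := by positivity
    calc 2 * (K * (u ^ 2 + 1 / (i : ℝ))) * (1 + |α * u|)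
        ≤ 2 * (K * (u ^ 2 + 1 / (i : ℝ))) * (1 + α) := by gcongr
      _ ≤ _ := by linarith
  · have h1 := abs_sub_div_add_le_one (hr y) (hb x)
    rw [add_comm (r y)] at h1
    have h2 : 1 + α ≤ (1 + α) / δ' * (u ^ 2 + 1 / (i : ℝ)) := by
      rw [div_mul_eq_mul_div, le_div_iff₀ hδ'0]
      gcongr
    have h3 : 0 ≤ 2 * K * (1 + α) * (u ^ 2 + 1 / (i : ℝ)) := by positivity
    have := abs_add_le ((r y - b x) / (b x + r y)) (α * u)
    linarith

namespace Urn

variable {Ω : Type*} [MeasurableSpace Ω] {μ : Measure Ω} {b r : ℕ → ℝ}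

lemma measurable_F_comp (U : Urn μ b r) (n : ℕ) (f : ℕ × ℕ → ℝ) :
    Measurable[U.F n] fun ω => f (U.Bl n ω, U.Re n ω) := by
  have hle : MeasurableSpace.comap (fun ω => (U.Bl n ω, U.Re n ω)) inferInstance ≤ U.F n :=
    le_iSup₂_of_le n (Set.mem_Iic.mpr le_rfl) le_rfl
  exact ((measurable_of_countable f).comp (comap_measurable _)).mono hle le_rfl

lemma D_succ_sub (U : Urn μ b r) (n : ℕ) (ω : Ω) :
    ((U.D (n + 1) ω : ℝ) - (U.D n ω : ℝ))
      = 1 - 2 * (if U.Bl (n + 1) ω = U.Bl n ω + 1 then (1 : ℝ) else 0) := by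
  unfold D
  rcases U.step n ω with ⟨h1, h2⟩ | ⟨h1, h2⟩
  · rw [if_pos h1, h1, h2]
    push_cast
    ring
  · rw [if_neg (by omega), h1, h2]
    push_cast
    ring

lemma condExp_D_succ_sub [IsProbabilityMeasure μ] (U : Urn μ b r) (hb : ∀ i, 0 < b i)
    (hr : ∀ i, 0 < r i) (n : ℕ) :
    μ[(fun ω => ((U.D (n + 1) ω : ℝ) - (U.D n ω : ℝ))) | U.F n]
      =ᵐ[μ] fun ω => (r (U.Re n ω) - b (U.Bl n ω)) / (b (U.Bl n ω) + r (U.Re n ω)) := by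
  set g : Ω → ℝ := fun ω => if U.Bl (n + 1) ω = U.Bl n ω + 1 then (1 : ℝ) else 0 with hg
  have hgm : Measurable g := by
    refine Measurable.ite ?_ measurable_const measurable_const
    exact measurableSet_eq_fun (U.meas_Bl (n + 1)) ((U.meas_Bl n).add_const 1)
  have hgi : Integrable g μ := by
    refine Integrable.of_bound hgm.aestronglyMeasurable 1 (Eventually.of_forall fun ω => ?_)
    simp only [hg]
    split_ifs <;> simp
  have heq : (fun ω => ((U.D (n + 1) ω : ℝ) - (U.D n ω : ℝ)))
      = (fun _ => (1 : ℝ)) - (2 : ℝ) • g := by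
    ext ω
    simp [U.D_succ_sub n ω, hg]
  rw [heq]
  have h1 := condExp_sub (integrable_const (1 : ℝ)) (hgi.smul (2 : ℝ)) (U.F n) (μ := μ)
  have h2 := condExp_smul (2 : ℝ) g (U.F n) (μ := μ)
  have h3 : μ[g | U.F n] =ᵐ[μ] fun ω => b (U.Bl n ω) / (b (U.Bl n ω) + r (U.Re n ω)) :=
    U.markov n
  filter_upwards [h1, h2, h3] with ω h1 h2 h3
  rw [h1, Pi.sub_apply, condExp_const (U.F_le n), h2, Pi.smul_apply, h3, smul_eq_mul]
  have := hb (U.Bl n ω)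
  have := hr (U.Re n ω)
  field_simp
  ring

end Urn

theorem condexp_discrepancy_increment {Ω : Type*} [MeasurableSpace Ω] (μ : MeasureTheory.Measure Ω) [MeasureTheory.IsProbabilityMeasure μ]
    (α B : ℝ) (hα : 0 < α) (w : ℕ → ℝ) (hw : ∀ n, 0 < w n)
    (hasymp : WeightAsymp w α B)
    (b r : ℕ → ℝ) (hb : ∀ i, 0 < b i) (hr : ∀ i, 0 < r i)
    (hchoice : UrnChoice w b r) (U : Urn μ b r) :
    ∃ C > (0:ℝ), ∀ i : ℕ, 1 ≤ i → ∃ ε : Ω → ℝ,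
      Measurable[U.F i] ε ∧
      (μ[(fun ω => ((U.D (i+1) ω : ℝ) - (U.D i ω : ℝ))) | U.F i]
        =ᵐ[μ] fun ω => -α * (U.D i ω : ℝ) / (i:ℝ) + ε ω) ∧
      (∀ᵐ ω ∂μ, |ε ω| ≤ C * ((U.D i ω : ℝ)^2 + (i:ℝ)) / (i:ℝ)^2) := by
  obtain ⟨C, hC, h⟩ := exists_drift_bound hα hasymp hb hr hchoice
  refine ⟨C, hC, fun i hi => ?_⟩
  refine ⟨fun ω => (r (U.Re i ω) - b (U.Bl i ω)) / (b (U.Bl i ω) + r (U.Re i ω))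
    + α * ((U.Re i ω : ℝ) - U.Bl i ω) / i, ?_, ?_, ?_⟩
  · exact U.measurable_F_comp i fun p =>
      (r p.2 - b p.1) / (b p.1 + r p.2) + α * ((p.2 : ℝ) - p.1) / i
  · filter_upwards [U.condExp_D_succ_sub hb hr i] with ω hω
    rw [hω]
    simp only [Urn.D]
    push_cast
    ring
  · refine Eventually.of_forall fun ω => ?_
    simpa [Urn.D] using h i _ _ hi (U.Bl_add_Re i ω)
end
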